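/- Let A = (a_{ij}) be a positive semidefinite real n×n matrix. Then det A ≤ a_{11}·a_{22}···a_{nn} (Hadamard's inequality for positive semidefinite matrices). -/

import Mathlib

namespace Matrix

variable {ι : Type*} [Fintype ι] [DecidableEq ι]

theorem PosSemidef.det_le_exp_trace_sub_card {A : Matrix ι ι ℝ} (hA : A.PosSemidef) :
    A.det ≤ Real.exp (A.trace - Fintype.card ι) := by
  have hdet : A.det = ∏ i, hA.isHermitian.eigenvalues i := by
    simpa using hA.isHermitian.det_eq_prod_eigenvalues
  have htrace : A.trace = ∑ i, hA.isHermitian.eigenvalues i := by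
    simpa using hA.isHermitian.trace_eq_sum_eigenvalues
  calc A.det = ∏ i, hA.isHermitian.eigenvalues i := hdet
    _ ≤ ∏ i, Real.exp (hA.isHermitian.eigenvalues i - 1) :=
        Finset.prod_le_prod (fun i _ ↦ hA.eigenvalues_nonneg i)
          fun i _ ↦ by simpa using Real.add_one_le_exp (hA.isHermitian.eigenvalues i - 1)
    _ = Real.exp (A.trace - Fintype.card ι) := by
        rw [← Real.exp_sum, htrace]
        simp

/-- **Hadamard's inequality** for positive definite matrices. -/
theorem PosDef.det_le_prod_diag {A : Matrix ι ι ℝ} (hA : A.PosDef) :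
    A.det ≤ ∏ i, A i i := by
  have hpos : ∀ i, 0 < A i i := fun i ↦ hA.diag_pos
  let D : Matrix ι ι ℝ := diagonal fun i ↦ (√(A i i))⁻¹
  have hB : (D * A * D).PosSemidef := by
    simpa [D, diagonal_conjTranspose] using hA.posSemidef.mul_mul_conjTranspose_same D
  have htrace : (D * A * D).trace = Fintype.card ι := by
    have hdiag : ∀ i, (√(A i i))⁻¹ * A i i * (√(A i i))⁻¹ = 1 := fun i ↦ by
      have := Real.sqrt_pos.2 (hpos i)
      field_simp
      exact (Real.sq_sqrt (hpos i).le).symm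
    simp [trace, D, hdiag]
  have hdet : (D * A * D).det = A.det / ∏ i, A i i := by
    have hsq : (∏ i, √(A i i)) ^ 2 = ∏ i, A i i := by
      rw [← Finset.prod_pow]
      exact Finset.prod_congr rfl fun i _ ↦ Real.sq_sqrt (hpos i).le
    rw [← hsq]
    simp only [D, det_mul, det_diagonal, Finset.prod_inv_distrib]
    ring
  have hle := hB.det_le_exp_trace_sub_card
  rwa [htrace, sub_self, Real.exp_zero, hdet,
    div_le_one (Finset.prod_pos fun i _ ↦ hpos i)] at hle

end Matrix

/-- Hadamard's inequality for positive semidefinite matrices: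
`det A ≤ a₁₁ a₂₂ ⋯ aₙₙ`. -/
theorem stmt8 {n : ℕ} (A : Matrix (Fin n) (Fin n) ℝ) (hA : A.PosSemidef) :
    A.det ≤ ∏ i, A i i := by
  by_cases h : A.det = 0
  · rw [h]
    exact Finset.prod_nonneg fun i _ ↦ hA.diag_nonneg
  · exact (hA.posDef_iff_isUnit.2 (A.isUnit_iff_isUnit_det.2 (isUnit_iff_ne_zero.2 h))).det_le_prod_diag
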